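/- arXiv:2303.06967 — 6 statements merged into one kernel-verified Lean document; each statement's English description precedes it below -/
import Mathlib

section
/- Let K ⊆ ℝⁿ be a compact polyhedron with a simplicial decomposition (S_i)_{i∈I}, let f : ℝⁿ → ℝ be of class C¹, and assume V ∩ ∂K = ∅. If for every x ∈ K(f) the origin 0 does not belong to the convex hull of G(f,x), then V and Ṽ are isotopic: there exists a continuous map H : [0,1] × K → K such that for each t the map H(t,·) is a homeomorphism of K onto itself, H(0,·) is the identity, and H(1,·) maps V onto Ṽ. -/
open Set RealInnerProductSpace

open Filter Topology in
/-- A bounded Lipschitz vector field on a Banach space generates a global flow. -/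
theorem exists_flow_of_lipschitzWith_of_bounded {E : Type*} [NormedAddCommGroup E]
    [NormedSpace ℝ E] [CompleteSpace E] {X : E → E} {C L : NNReal} (hX : LipschitzWith C X)
    (hL : ∀ x, ‖X x‖ ≤ L) :
    ∃ φ : Flow ℝ E, (∀ x t, HasDerivAt (fun s => φ s x) (X (φ t x)) t) ∧
      ∀ x, X x = 0 → ∀ t, φ t x = x := by
  have hpl : ∀ R : NNReal, ∃ α : E × ℝ → E, (∀ x ∈ Metric.closedBall (0 : E) R, α (x, 0) = x ∧
      ∀ t ∈ Icc (-(R : ℝ)) R, HasDerivWithinAt (fun s => α (x, s)) (X (α (x, t)))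
        (Icc (-(R : ℝ)) R) t) ∧
      ContinuousOn α (Metric.closedBall (0 : E) R ×ˢ Icc (-(R : ℝ)) R) := by
    intro R
    have h : IsPicardLindelof (fun _ => X) (tmin := -(R : ℝ)) (tmax := R)
        ⟨0, by simp⟩ (0 : E) (L * R + R) R L C :=
      { lipschitzOnWith := fun t _ => hX.lipschitzOnWith
        continuousOn := fun x _ => continuousOn_const
        norm_le := fun t _ x _ => hL x
        mul_max_le := by simp }
    exact h.exists_forall_mem_closedBall_eq_hasDerivWithinAt_continuousOn
  choose α hα hαc using hpl
  have hderiv : ∀ (R : NNReal) (x : E) (t : ℝ), ‖x‖ ≤ R → |t| < R →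
      HasDerivAt (fun s => α R (x, s)) (X (α R (x, t))) t := by
    intro R x t hx ht
    rw [abs_lt] at ht
    exact ((hα R x (by simpa using hx)).2 t ⟨ht.1.le, ht.2.le⟩).hasDerivAt
      (Icc_mem_nhds ht.1 ht.2)
  have huniq : ∀ (R R' : NNReal) (x : E) (t : ℝ), ‖x‖ ≤ R → |t| < R → R ≤ R' →
      α R (x, t) = α R' (x, t) := by
    intro R R' x t hx ht hR
    have hR' : (R : ℝ) ≤ R' := by exact_mod_cast hR
    have hpos : (0 : ℝ) < R := (abs_nonneg t).trans_lt ht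
    refine ODE_solution_unique_of_mem_Ioo (v := fun _ => X) (s := fun _ => univ) (t₀ := 0)
      (K := C) (a := -R) (b := R) (f := fun s => α R (x, s)) (g := fun s => α R' (x, s))
      (fun t _ => hX.lipschitzOnWith) ⟨by linarith, hpos⟩
      (fun s hs => ⟨hderiv R x s hx (abs_lt.2 hs), trivial⟩)
      (fun s hs => ⟨hderiv R' x s (hx.trans hR') ((abs_lt.2 hs).trans_le hR'), trivial⟩)
      ?_ (abs_lt.1 ht)
    rw [(hα R x (by simpa using hx)).1, (hα R' x (by simpa using hx.trans hR')).1]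
  let Φ : ℝ → E → E := fun t x => α (‖x‖₊ + ‖t‖₊ + 1) (x, t)
  have hΦ : ∀ (R : NNReal) (x : E) (t : ℝ), ‖x‖ ≤ R → |t| < R → Φ t x = α R (x, t) := by
    intro R x t hx ht
    have h1 : ‖x‖ ≤ ((‖x‖₊ + ‖t‖₊ + 1 : NNReal) : ℝ) := by
      have := norm_nonneg t
      push_cast; linarith
    have h2 : |t| < ((‖x‖₊ + ‖t‖₊ + 1 : NNReal) : ℝ) := by
      have := norm_nonneg x
      push_cast; rw [Real.norm_eq_abs]; linarith
    rcases le_total R (‖x‖₊ + ‖t‖₊ + 1) with h | h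
    · exact (huniq _ _ x t hx ht h).symm
    · exact huniq _ _ x t h1 h2 h
  have hΦd : ∀ x t, HasDerivAt (fun s => Φ s x) (X (Φ t x)) t := by
    intro x t
    let R : NNReal := ‖x‖₊ + ‖t‖₊ + 1
    have h1 : ‖x‖ ≤ (R : ℝ) := by
      have := norm_nonneg t
      simp only [R]; push_cast; linarith
    have h2 : |t| < (R : ℝ) := by
      have := norm_nonneg x
      simp only [R]; push_cast; rw [Real.norm_eq_abs]; linarith
    have h := hderiv R x t h1 h2
    rw [← hΦ R x t h1 h2] at h
    refine h.congr_of_eventuallyEq ?_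
    filter_upwards [(isOpen_lt continuous_abs continuous_const).mem_nhds h2] with s hs
    exact hΦ R x s h1 hs
  have hΦ0 : ∀ x, Φ 0 x = x := fun x =>
    (hα _ x (by simp)).1
  refine ⟨⟨Φ, ?_, ?_, hΦ0⟩, hΦd, fun x hx t => ?_⟩
  · rw [continuous_iff_continuousAt]
    rintro ⟨t, x⟩
    let R : NNReal := ‖x‖₊ + ‖t‖₊ + 1
    have h1 : ‖x‖ < (R : ℝ) := by
      have := norm_nonneg t
      simp only [R]; push_cast; linarith
    have h2 : |t| < (R : ℝ) := by
      have := norm_nonneg x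
      simp only [R]; push_cast; rw [Real.norm_eq_abs]; linarith
    have hc : ContinuousAt (α R) (x, t) := by
      refine (hαc R).continuousAt (prod_mem_nhds ?_ ?_)
      · exact Metric.closedBall_mem_nhds_of_mem (by simpa using h1)
      · exact Icc_mem_nhds (abs_lt.1 h2).1 (abs_lt.1 h2).2
    have hc' : ContinuousAt (fun p : ℝ × E => α R (p.2, p.1)) (t, x) :=
      ContinuousAt.comp (f := fun p : ℝ × E => (p.2, p.1)) hc (by fun_prop)
    refine hc'.congr ?_
    have e1 : ∀ᶠ p : ℝ × E in 𝓝 (t, x), ‖p.2‖ < R :=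
      (isOpen_lt (by fun_prop) continuous_const).mem_nhds h1
    have e2 : ∀ᶠ p : ℝ × E in 𝓝 (t, x), |p.1| < R :=
      (isOpen_lt (by fun_prop) continuous_const).mem_nhds h2
    filter_upwards [e1, e2] with p hp1 hp2
    exact (hΦ R p.2 p.1 hp1.le hp2).symm
  · intro t₁ t₂ x
    have := ODE_solution_unique_univ (v := fun _ => X) (s := fun _ => univ) (t₀ := 0)
      (K := C) (f := fun s => Φ (s + t₂) x) (g := fun s => Φ s (Φ t₂ x))
      (fun _ => hX.lipschitzOnWith)
      (fun s => ⟨(hΦd x (s + t₂)).comp_add_const s t₂, trivial⟩)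
      (fun s => ⟨hΦd _ s, trivial⟩) (by simp [hΦ0])
    exact congrFun this t₁
  · have := ODE_solution_unique_univ (v := fun _ => X) (s := fun _ => univ) (t₀ := 0)
      (K := C) (f := fun s => Φ s x) (g := fun _ => x) (fun _ => hX.lipschitzOnWith)
      (fun s => ⟨hΦd x s, trivial⟩)
      (fun s => ⟨by rw [hx]; exact hasDerivAt_const s x, trivial⟩) (hΦ0 x)
    exact congrFun this t

namespace Flow

variable {Y : Type*} [TopologicalSpace Y] (φ : Flow ℝ Y)

/-- A function is transverse to a flow at its zero set if it is monotone along every orbit and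
positive right after each of its zeros. -/
structure IsTransverseAtZeros (f : Y → ℝ) : Prop where
  continuous : Continuous f
  monotone : ∀ x, Monotone fun s => f (φ s x)
  pos : ∀ x, f x = 0 → ∀ s > 0, 0 < f (φ s x)

namespace IsTransverseAtZeros

variable {φ} {f : Y → ℝ}

theorem pos_of_lt (h : φ.IsTransverseAtZeros f) {x : Y} {s t : ℝ}
    (hs : f (φ s x) = 0) (hst : s < t) : 0 < f (φ t x) := by
  have := h.pos _ hs (t - s) (sub_pos.2 hst)
  rwa [← φ.map_add, sub_add_cancel] at this

theorem neg_of_lt (h : φ.IsTransverseAtZeros f) {x : Y} {s t : ℝ}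
    (hs : f (φ s x) = 0) (hts : t < s) : f (φ t x) < 0 := by
  refine lt_of_le_of_ne (hs ▸ h.monotone x hts.le) fun h0 => ?_
  exact (h.pos_of_lt h0 hts).ne' hs

theorem eq_of_eq_zero (h : φ.IsTransverseAtZeros f) {x : Y} {s t : ℝ}
    (hs : f (φ s x) = 0) (ht : f (φ t x) = 0) : s = t := by
  rcases lt_trichotomy s t with hst | hst | hst
  · exact absurd ht (h.pos_of_lt hs hst).ne'
  · exact hst
  · exact absurd hs (h.pos_of_lt ht hst).ne'

theorem continuous_orbit (h : φ.IsTransverseAtZeros f) (x : Y) : Continuous fun s => f (φ s x) :=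
  h.continuous.comp (φ.continuous continuous_id continuous_const)

theorem continuous_time (h : φ.IsTransverseAtZeros f) (s : ℝ) : Continuous fun x => f (φ s x) :=
  h.continuous.comp (φ.continuous continuous_const continuous_id)

theorem exists_zero (h : φ.IsTransverseAtZeros f) {x : Y} {s t : ℝ} (hst : s ≤ t)
    (hs : f (φ s x) ≤ 0) (ht : 0 ≤ f (φ t x)) :
    ∃ u ∈ Icc s t, f (φ u x) = 0 :=
  intermediate_value_Icc hst (h.continuous_orbit x).continuousOn ⟨hs, ht⟩

theorem eventually_exists_zero (h : φ.IsTransverseAtZeros f) {x : Y} {s : ℝ}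
    (hs : f (φ s x) = 0) {ε : ℝ} (hε : 0 < ε) :
    ∀ᶠ y in nhds x, ∃ u ∈ Icc (s - ε) (s + ε), f (φ u y) = 0 := by
  have e1 : ∀ᶠ y in nhds x, f (φ (s - ε) y) < 0 :=
    (isOpen_lt (h.continuous_time _) continuous_const).mem_nhds (h.neg_of_lt hs (by linarith))
  have e2 : ∀ᶠ y in nhds x, 0 < f (φ (s + ε) y) :=
    (isOpen_lt continuous_const (h.continuous_time _)).mem_nhds (h.pos_of_lt hs (by linarith))
  filter_upwards [e1, e2] with y h1 h2
  exact h.exists_zero (by linarith) h1.le h2.le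

theorem isOpen_setOf_exists_zero (h : φ.IsTransverseAtZeros f) :
    IsOpen {x | ∃ s, f (φ s x) = 0} := by
  rw [isOpen_iff_mem_nhds]
  rintro x ⟨s, hs⟩
  filter_upwards [h.eventually_exists_zero hs one_pos] with y ⟨u, _, hu⟩
  exact ⟨u, hu⟩

theorem continuousAt_of_eq_zero (h : φ.IsTransverseAtZeros f) {a : Y → ℝ}
    (ha : ∀ x, (∃ s, f (φ s x) = 0) → f (φ (a x) x) = 0) {x : Y} (hx : ∃ s, f (φ s x) = 0) :
    ContinuousAt a x := by
  rw [Metric.continuousAt_iff']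
  intro ε hε
  filter_upwards [h.eventually_exists_zero (ha x hx) (half_pos hε)] with y ⟨u, hu, hu0⟩
  rw [h.eq_of_eq_zero (ha y ⟨u, hu0⟩) hu0, Real.dist_eq, abs_lt]
  constructor <;> linarith [hu.1, hu.2]

theorem exists_zero_of_mul_pos (h : φ.IsTransverseAtZeros f) {g : Y → ℝ}
    (hg : φ.IsTransverseAtZeros g) {x : Y} (hx : f x = 0)
    (hfut : ∃ s ≥ 0, 0 < f (φ s x) * g (φ s x)) (hpast : ∃ s ≤ 0, 0 < f (φ s x) * g (φ s x)) :
    ∃ s, g (φ s x) = 0 := by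
  have hx0 : f (φ 0 x) = 0 := by rwa [φ.map_zero_apply]
  rcases le_total (g (φ 0 x)) 0 with hg0 | hg0
  · obtain ⟨s, hs, hpos⟩ := hfut
    have hfs : 0 ≤ f (φ s x) := hx0.symm.trans_le (h.monotone x hs)
    obtain ⟨u, _, hu⟩ := hg.exists_zero hs hg0 (pos_of_mul_pos_right hpos hfs).le
    exact ⟨u, hu⟩
  · obtain ⟨s, hs, hpos⟩ := hpast
    have hfs : f (φ s x) ≤ 0 := (h.monotone x hs).trans_eq hx0
    obtain ⟨u, _, hu⟩ := hg.exists_zero hs (neg_of_mul_pos_right hpos hfs).le hg0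
    exact ⟨u, hu⟩

end IsTransverseAtZeros

/-- If two functions are transverse to a flow at their zero sets and every orbit that meets one
zero set meets the other, then the two zero sets are ambient isotopic. -/
theorem exists_isotopy_of_isTransverseAtZeros [CompactSpace Y] {f g : Y → ℝ}
    (hf : φ.IsTransverseAtZeros f) (hg : φ.IsTransverseAtZeros g)
    (hfg : ∀ x, f x = 0 → ∃ s, g (φ s x) = 0) (hgf : ∀ x, g x = 0 → ∃ s, f (φ s x) = 0) :
    ∃ H : ℝ × Y → Y, Continuous H ∧
      (∀ t ∈ Icc (0 : ℝ) 1, Function.Bijective fun x => H (t, x)) ∧ (∀ x, H (0, x) = x) ∧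
      (fun x => H (1, x)) '' {x | f x = 0} = {x | g x = 0} := by
  classical
  have hex : ∀ x, (∃ s, f (φ s x) = 0) ↔ ∃ s, g (φ s x) = 0 := by
    refine fun x => ⟨fun ⟨s, hs⟩ => ?_, fun ⟨s, hs⟩ => ?_⟩
    · obtain ⟨t, ht⟩ := hfg _ hs
      exact ⟨t + s, by rwa [φ.map_add]⟩
    · obtain ⟨t, ht⟩ := hgf _ hs
      exact ⟨t + s, by rwa [φ.map_add]⟩
  have hchoice : ∀ k : Y → ℝ, ∃ a : Y → ℝ, ∀ x, (∃ s, k (φ s x) = 0) → k (φ (a x) x) = 0 :=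
    fun k => ⟨fun x => if hx : ∃ s, k (φ s x) = 0 then hx.choose else 0,
      fun x hx => by simpa only [dif_pos hx] using hx.choose_spec⟩
  obtain ⟨a, ha⟩ := hchoice f
  obtain ⟨b, hb⟩ := hchoice g
  let W : Set Y := {x | ∃ s, f (φ s x) = 0}
  have hWinv : ∀ {x : Y} (s : ℝ), x ∈ W → φ s x ∈ W := by
    rintro x s ⟨t, ht⟩
    exact ⟨t - s, by rwa [← φ.map_add, sub_add_cancel]⟩
  have haeq : ∀ {x : Y} (s : ℝ), x ∈ W → a (φ s x) = a x - s := by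
    intro x s hx
    refine hf.eq_of_eq_zero (ha _ (hWinv s hx)) ?_
    rw [← φ.map_add, sub_add_cancel]
    exact ha x hx
  have hbeq : ∀ {x : Y} (s : ℝ), x ∈ W → b (φ s x) = b x - s := by
    intro x s hx
    refine hg.eq_of_eq_zero (hb _ ((hex _).1 (hWinv s hx))) ?_
    rw [← φ.map_add, sub_add_cancel]
    exact hb x ((hex _).1 hx)
  have hac : ContinuousOn a W := fun x hx =>
    (hf.continuousAt_of_eq_zero ha hx).continuousWithinAt
  have hbc : ContinuousOn b W := fun x hx =>
    (hg.continuousAt_of_eq_zero hb ((hex _).1 hx)).continuousWithinAt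
  have hVW : {x | f x = 0} ⊆ W := fun x hx => ⟨0, by rwa [φ.map_zero_apply]⟩
  have hVa : ∀ {x}, f x = 0 → a x = 0 := fun {x} hx =>
    hf.eq_of_eq_zero (ha x (hVW hx)) (by rwa [φ.map_zero_apply])
  obtain ⟨M, hM⟩ : ∃ M : ℝ, ∀ x ∈ W, |b x - a x| < M := by
    have hVc : IsCompact {x | f x = 0} :=
      (isClosed_eq hf.continuous continuous_const).isCompact
    obtain ⟨M, hM⟩ := hVc.exists_bound_of_continuousOn ((hbc.sub hac).mono hVW)
    refine ⟨M + 1, fun x hx => ?_⟩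
    have := hM (φ (a x) x) (ha x hx)
    simp only [Pi.sub_apply, haeq _ hx, hbeq _ hx, Real.norm_eq_abs] at this
    rw [show b x - a x - (a x - a x) = b x - a x by ring] at this
    linarith
  let τ : Y → ℝ := fun x => if x ∈ W then (b x - a x) * max 0 (1 - |a x| / M) else 0
  have hτW : ∀ {x}, x ∈ W → τ x = (b x - a x) * max 0 (1 - |a x| / M) := fun hx => if_pos hx
  have hτW' : ∀ {x}, x ∉ W → τ x = 0 := fun hx => if_neg hx
  have hτc : Continuous τ := by
    rw [continuous_iff_continuousAt]
    intro x
    by_cases hx : x ∈ W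
    · have hc : ContinuousOn (fun x => (b x - a x) * max 0 (1 - |a x| / M)) W :=
        (hbc.sub hac).mul (continuousOn_const.sup (continuousOn_const.sub
          ((continuous_abs.comp_continuousOn hac).div_const M)))
      refine (hc.continuousAt (hf.isOpen_setOf_exists_zero.mem_nhds hx)).congr ?_
      filter_upwards [hf.isOpen_setOf_exists_zero.mem_nhds hx] with y hy
      exact (hτW hy).symm
    · suffices h : ∀ᶠ y in nhds x, 0 = τ y from continuousAt_const.congr h
      by_cases hM0 : 0 ≤ M
      · have hC : IsClosed {y | f (φ (-M) y) ≤ 0 ∧ 0 ≤ f (φ M y)} :=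
          (isClosed_le (hf.continuous_time _) continuous_const).inter
            (isClosed_le continuous_const (hf.continuous_time _))
        have hxC : x ∈ {y | f (φ (-M) y) ≤ 0 ∧ 0 ≤ f (φ M y)}ᶜ := by
          rintro ⟨h1, h2⟩
          obtain ⟨u, _, hu⟩ := hf.exists_zero (by linarith) h1 h2
          exact hx ⟨u, hu⟩
        filter_upwards [hC.isOpen_compl.mem_nhds hxC] with y hy
        by_cases hyW : y ∈ W
        · rw [hτW hyW]
          by_cases haM : |a y| ≤ M
          · rw [abs_le] at haM
            exact absurd ⟨(hf.monotone y haM.1).trans_eq (ha y hyW),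
              (ha y hyW).symm.trans_le (hf.monotone y haM.2)⟩ hy
          · have hMpos : 0 < M := (abs_nonneg _).trans_lt (hM y hyW)
            have : 1 ≤ |a y| / M := by rw [one_le_div hMpos]; linarith
            rw [max_eq_left (by linarith), mul_zero]
        · exact (hτW' hyW).symm
      · refine Filter.Eventually.of_forall fun y => (hτW' fun hy => ?_).symm
        exact hM0 ((abs_nonneg _).trans (hM y hy).le)
  have hτb : ∀ x, |τ x| ≤ |M| := by
    intro x
    by_cases hx : x ∈ W
    · have hMpos : 0 < M := (abs_nonneg _).trans_lt (hM x hx)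
      have h1 : 0 ≤ |a x| / M := by positivity
      rw [hτW hx, abs_mul, abs_of_pos hMpos]
      have h2 : |max 0 (1 - |a x| / M)| ≤ 1 := by
        rw [abs_of_nonneg (le_max_left _ _)]
        exact max_le zero_le_one (by linarith)
      calc _ ≤ |b x - a x| * 1 := by gcongr
        _ ≤ M := by rw [mul_one]; exact (hM x hx).le
    · rw [hτW' hx, abs_zero]; positivity
  have hτlip : ∀ {x : Y} (s : ℝ), s ≠ 0 → x ∈ W → |τ (φ s x) - τ x| < |s| := by
    intro x s hs hx
    have hMpos : 0 < M := (abs_nonneg _).trans_lt (hM x hx)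
    rw [hτW hx, hτW (hWinv s hx), haeq s hx, hbeq s hx,
      show b x - s - (a x - s) = b x - a x by ring, ← mul_sub, abs_mul]
    have h1 : |max 0 (1 - |a x - s| / M) - max 0 (1 - |a x| / M)| ≤ |s| / M := by
      refine (abs_max_sub_max_le_max _ _ _ _).trans ?_
      rw [sub_self, abs_zero, max_eq_right (abs_nonneg _),
        show 1 - |a x - s| / M - (1 - |a x| / M) = (|a x| - |a x - s|) / M by ring, abs_div,
        abs_of_pos hMpos]
      have h0 := abs_abs_sub_abs_le (a x) (a x - s)
      rw [sub_sub_cancel] at h0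
      exact div_le_div_of_nonneg_right h0 hMpos.le
    calc _ ≤ |b x - a x| * (|s| / M) := by gcongr
      _ < M * (|s| / M) := by
        have : 0 < |s| / M := div_pos (abs_pos.2 hs) hMpos
        gcongr
        exact hM x hx
      _ = |s| := by field_simp
  refine ⟨fun p => φ (p.1 * τ p.2) p.2, ?_, ?_, ?_, ?_⟩
  · exact φ.continuous (continuous_fst.mul (hτc.comp continuous_snd)) continuous_snd
  · intro t ht
    constructor
    · intro x y hxy
      have hxy' : φ (t * τ x) x = φ (t * τ y) y := hxy
      have hy : y = φ (t * τ x - t * τ y) x := by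
        rw [show t * τ x - t * τ y = -(t * τ y) + t * τ x by ring, φ.map_add, hxy',
          ← φ.map_add, neg_add_cancel, φ.map_zero_apply]
      by_contra hne
      have hs : t * τ x - t * τ y ≠ 0 := by
        intro h0
        rw [h0, φ.map_zero_apply] at hy
        exact hne hy.symm
      by_cases hx : x ∈ W
      · have h1 := hτlip _ hs hx
        rw [← hy, ← mul_sub, abs_mul, abs_of_nonneg ht.1, abs_sub_comm] at h1
        have h2 : t * |τ x - τ y| ≤ 1 * |τ x - τ y| := by gcongr; exact ht.2
        linarith
      · have hyW : y ∉ W := by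
          intro hyW
          refine hx ?_
          have := hWinv (-(t * τ x - t * τ y)) hyW
          rwa [hy, ← φ.map_add, ← hy, neg_add_cancel, φ.map_zero_apply] at this
        exact hs (by rw [hτW' hx, hτW' hyW, sub_self])
    · intro y
      have hc : Continuous fun s => s + t * τ (φ s y) :=
        continuous_id.add (continuous_const.mul
          (hτc.comp (φ.continuous continuous_id continuous_const)))
      have hbd : ∀ z, |t * τ z| ≤ |M| := by
        intro z
        rw [abs_mul, abs_of_nonneg ht.1]
        calc t * |τ z| ≤ 1 * |τ z| := by gcongr; exact ht.2
          _ ≤ |M| := by rw [one_mul]; exact hτb z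
      obtain ⟨s, -, hs⟩ := intermediate_value_Icc (a := -|M|) (b := |M|)
        (by linarith [abs_nonneg M]) hc.continuousOn (show (0 : ℝ) ∈ _ from
          ⟨by linarith [(abs_le.1 (hbd (φ (-|M|) y))).2],
            by linarith [(abs_le.1 (hbd (φ (|M|) y))).1]⟩)
      refine ⟨φ s y, ?_⟩
      simp only
      have hs0 : t * τ (φ s y) + s = 0 := (add_comm _ _).trans hs
      rw [← φ.map_add, hs0, φ.map_zero_apply]
  · intro x
    simp only [zero_mul, φ.map_zero_apply]
  · have hτV : ∀ {x}, f x = 0 → τ x = b x := by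
      intro x hx
      rw [hτW (hVW hx), hVa hx]
      simp
    ext y
    simp only [one_mul, mem_image, mem_ofPred_eq]
    constructor
    · rintro ⟨x, hx, rfl⟩
      rw [hτV hx]
      exact hb x ((hex x).1 (hVW hx))
    · intro hy
      have hyW : y ∈ W := (hex y).2 ⟨0, by rwa [φ.map_zero_apply]⟩
      have hby : b y = 0 :=
        hg.eq_of_eq_zero (hb y ((hex y).1 hyW)) (by rwa [φ.map_zero_apply])
      refine ⟨φ (a y) y, ha y hyW, ?_⟩
      rw [hτV (ha y hyW), hbeq _ hyW, ← φ.map_add, hby, zero_sub, neg_add_cancel,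
        φ.map_zero_apply]

end Flow

/-- If `0` is not in the convex hull of a finite set, some vector has positive inner product with
all its points. -/
theorem Set.Finite.exists_forall_inner_pos {E : Type*} [NormedAddCommGroup E]
    [InnerProductSpace ℝ E] [CompleteSpace E] {G : Set E} (hG : G.Finite)
    (h0 : (0 : E) ∉ convexHull ℝ G) : ∃ e : E, ∀ g ∈ G, 0 < ⟪g, e⟫ := by
  obtain ⟨ℓ, u, hu, hℓ⟩ := geometric_hahn_banach_point_closed (convex_convexHull ℝ G)
    (hG.isClosed_convexHull ℝ) h0
  refine ⟨(InnerProductSpace.toDual ℝ E).symm ℓ, fun g hg => ?_⟩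
  rw [real_inner_comm, InnerProductSpace.toDual_symm_apply]
  rw [map_zero] at hu
  exact hu.trans (hℓ g (subset_convexHull ℝ G hg))

open Filter Topology in
/-- For a finite family of closed sets, points close to `x` only lie in members containing `x`. -/
theorem eventually_forall_mem_imp_mem {ι Y : Type*} [Finite ι] [TopologicalSpace Y]
    {S : ι → Set Y} (hS : ∀ i, IsClosed (S i)) (x : Y) :
    ∀ᶠ y in 𝓝 x, ∀ i, y ∈ S i → x ∈ S i := by
  rw [eventually_all]
  intro i
  by_cases hx : x ∈ S i
  · exact Eventually.of_forall fun _ _ => hx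
  · filter_upwards [(hS i).isOpen_compl.mem_nhds hx] with y hy hy'
    exact absurd hy' hy

open Filter Topology in
/-- Local vectors in the open dual cones of a set-valued map glue to a vector field. -/
theorem exists_vectorField_inner_pos {E : Type*} [NormedAddCommGroup E] [InnerProductSpace ℝ E]
    [FiniteDimensional ℝ E] {Z U : Set E} (hZ : IsCompact Z) (hU : IsOpen U) (hZU : Z ⊆ U)
    (G : E → Set E) (hG : ∀ x ∈ Z, ∃ e, ∀ᶠ y in 𝓝 x, ∀ g ∈ G y, 0 < ⟪g, e⟫) :
    ∃ X : E → E, ContDiff ℝ 1 X ∧ HasCompactSupport X ∧ (∀ x ∉ U, X x = 0) ∧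
      (∀ x, ∀ g ∈ G x, 0 ≤ ⟪g, X x⟫) ∧ ∀ x ∈ Z, ∀ g ∈ G x, 0 < ⟪g, X x⟫ := by
  have hloc : ∀ x : Z, ∃ (e : E) (b : ContDiffBump (x : E)),
      ∀ y ∈ Metric.ball (x : E) b.rOut, y ∈ U ∧ ∀ g ∈ G y, 0 < ⟪g, e⟫ := by
    rintro ⟨x, hx⟩
    obtain ⟨e, he⟩ := hG x hx
    obtain ⟨r, hr, hball⟩ :=
      Metric.eventually_nhds_iff_ball.1 ((hU.eventually_mem (hZU hx)).and he)
    exact ⟨e, ⟨r / 2, r, half_pos hr, half_lt_self hr⟩, hball⟩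
  choose e b hb using hloc
  obtain ⟨t, ht⟩ := hZ.elim_nhds_subcover' (fun x hx => Metric.ball x (b ⟨x, hx⟩).rOut)
    (fun x hx => Metric.ball_mem_nhds x (b ⟨x, hx⟩).rOut_pos)
  have hnn : ∀ (x : Z) (y : E), ∀ g ∈ G y, 0 ≤ b x y * ⟪g, e x⟫ := by
    intro x y g hg
    by_cases hy : y ∈ Metric.ball (x : E) (b x).rOut
    · exact mul_nonneg (b x).nonneg ((hb x y hy).2 g hg).le
    · rw [(b x).zero_of_le_dist (not_lt.1 hy), zero_mul]
  have hinner : ∀ y g, ⟪g, ∑ x ∈ t, b x y • e x⟫ = ∑ x ∈ t, b x y * ⟪g, e x⟫ := by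
    intro y g
    simp_rw [inner_sum, real_inner_smul_right]
  refine ⟨fun y => ∑ x ∈ t, b x y • e x, ?_, ?_, ?_, ?_, ?_⟩
  · exact ContDiff.sum fun x _ => (b x).contDiff.smul contDiff_const
  · have hc : IsCompact (⋃ x ∈ t, tsupport (b x)) :=
      t.isCompact_biUnion fun x _ => (b x).hasCompactSupport
    refine HasCompactSupport.intro hc fun y hy => Finset.sum_eq_zero fun x hx => ?_
    have : y ∉ tsupport (b x) := fun h => hy (mem_biUnion hx h)
    rw [image_eq_zero_of_notMem_tsupport this, zero_smul]
  · intro y hy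
    refine Finset.sum_eq_zero fun x _ => ?_
    have : y ∉ Metric.ball (x : E) (b x).rOut := fun h => hy (hb x y h).1
    rw [(b x).zero_of_le_dist (not_lt.1 this), zero_smul]
  · intro y g hg
    rw [hinner]
    exact Finset.sum_nonneg fun x _ => hnn x y g hg
  · intro y hy g hg
    rw [hinner]
    obtain ⟨x, hxt, hyx⟩ := mem_iUnion₂.1 (ht hy)
    exact Finset.sum_pos' (fun x _ => hnn x y g hg)
      ⟨x, hxt, mul_pos ((b x).pos_of_mem_ball hyx) ((hb x y hyx).2 g hg)⟩

section Simplicial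

variable {E : Type*} [NormedAddCommGroup E] [NormedSpace ℝ E]

/-- A face of a simplex containing a point with positive weights on `F` contains `F`. -/
theorem AffineIndependent.subset_of_sum_smul_mem_convexHull {s F F' : Finset E}
    (hs : AffineIndependent ℝ (fun v : (s : Set E) => (v : E))) (hF : F ⊆ s) (hF' : F' ⊆ s)
    {μ : E → ℝ} (hpos : ∀ v ∈ F, 0 < μ v) (hsum : ∑ v ∈ F, μ v = 1)
    (hmem : ∑ v ∈ F, μ v • v ∈ convexHull ℝ (F' : Set E)) : F ⊆ F' := by
  classical
  obtain ⟨ν, -, hν1, hνx⟩ := Finset.mem_convexHull'.1 hmem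
  have key : ∀ (A : Finset E) (_ : A ⊆ s) (η : E → ℝ),
      ∑ v ∈ s, (if v ∈ A then η v else 0) = ∑ v ∈ A, η v ∧
      ∑ v ∈ s, (if v ∈ A then η v else 0) • v = ∑ v ∈ A, η v • v := by
    intro A hA η
    simp_rw [ite_smul, zero_smul, Finset.sum_ite_mem, Finset.inter_eq_right.2 hA, and_self]
  have h := AffineIndependent.eq_of_sum_eq_sum_subtype (s := s) hs
    (w₁ := fun v => if v ∈ F then μ v else 0) (w₂ := fun v => if v ∈ F' then ν v else 0)
    (by rw [(key F hF μ).1, (key F' hF' ν).1, hsum, hν1])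
    (by rw [(key F hF μ).2, (key F' hF' ν).2, hνx])
  intro v hv
  by_contra hv'
  have := h v (hF hv)
  simp only [hv, hv', if_true, if_false] at this
  exact (hpos v hv).ne' this

variable {ι : Type*} [Finite ι] {verts : ι → Finset E}

open Filter Topology in
/-- In a simplicial decomposition, if one point of an open face is interior to the polyhedron then
so is every other point of that open face. -/
theorem sum_smul_mem_interior_iUnion_convexHull
    (hindep : ∀ i, AffineIndependent ℝ (fun v : (verts i : Set E) => (v : E)))
    (hface : ∀ i j, i ≠ j → ∃ F : Finset E, F ⊆ verts i ∧ F ⊆ verts j ∧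
      convexHull ℝ (verts i : Set E) ∩ convexHull ℝ (verts j : Set E) = convexHull ℝ (F : Set E))
    {i : ι} {F : Finset E} (hF : F ⊆ verts i) {μ ν : E → ℝ}
    (hμ : ∀ v ∈ F, 0 < μ v) (hμ1 : ∑ v ∈ F, μ v = 1)
    (hν : ∀ v ∈ F, 0 < ν v) (hν1 : ∑ v ∈ F, ν v = 1)
    (hy : ∑ v ∈ F, ν v • v ∈ interior (⋃ i, convexHull ℝ (verts i : Set E))) :
    ∑ v ∈ F, μ v • v ∈ interior (⋃ i, convexHull ℝ (verts i : Set E)) := by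
  set x := ∑ v ∈ F, μ v • v with hx
  set y := ∑ v ∈ F, ν v • v with hydef
  have hyi : y ∈ convexHull ℝ (F : Set E) :=
    Finset.mem_convexHull'.2 ⟨ν, fun v hv => (hν v hv).le, hν1, rfl⟩
  have hstar : ∀ j, y ∈ convexHull ℝ (verts j : Set E) → F ⊆ verts j := by
    intro j hj
    rcases eq_or_ne i j with rfl | hij
    · exact hF
    · obtain ⟨F', hFi, hFj, hint⟩ := hface i j hij
      refine ((hindep i).subset_of_sum_smul_mem_convexHull hF hFi hν hν1 ?_).trans hFj
      rw [← hint]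
      exact ⟨convexHull_mono (by exact_mod_cast hF) hyi, hj⟩
  obtain ⟨t, ht0, ht1, ht⟩ : ∃ t : ℝ, 0 < t ∧ t < 1 ∧ ∀ v ∈ F, t * ν v < μ v := by
    have h1 : ∀ᶠ t : ℝ in 𝓝[>] 0, ∀ v ∈ F, t * ν v < μ v := by
      rw [Finset.eventually_all]
      intro v hv
      refine nhdsWithin_le_nhds ((isOpen_lt (by fun_prop) continuous_const).mem_nhds ?_)
      simpa using hμ v hv
    obtain ⟨t, ⟨h, h'⟩, h''⟩ := ((eventually_mem_nhdsWithin.and h1).and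
      (nhdsWithin_le_nhds (Iio_mem_nhds one_pos))).exists
    exact ⟨t, h, h'', h'⟩
  have ht1' : 0 < 1 - t := sub_pos.2 ht1
  let y' := ∑ v ∈ F, ((1 - t)⁻¹ * (μ v - t * ν v)) • v
  have hy' : y' ∈ convexHull ℝ (F : Set E) := by
    refine Finset.mem_convexHull'.2 ⟨fun v => (1 - t)⁻¹ * (μ v - t * ν v), fun v hv => ?_, ?_, rfl⟩
    · have := ht v hv
      exact mul_nonneg (inv_pos.2 ht1').le (by linarith)
    · rw [← Finset.mul_sum, Finset.sum_sub_distrib, ← Finset.mul_sum, hμ1, hν1, mul_one,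
        inv_mul_cancel₀ ht1'.ne']
  have hxy : x = t • y + (1 - t) • y' := by
    simp only [y', hydef, hx, Finset.smul_sum, ← Finset.sum_add_distrib, smul_smul, ← add_smul]
    refine Finset.sum_congr rfl fun v _ => ?_
    congr 1
    field_simp
    ring
  let ψ : E → E := fun z => y + t⁻¹ • (z - x)
  have hψ : Tendsto ψ (𝓝 x) (𝓝 y) := by
    have : Continuous ψ := by fun_prop
    simpa [ψ] using this.tendsto x
  rw [mem_interior_iff_mem_nhds]
  have hclosed : ∀ i, IsClosed (convexHull ℝ (verts i : Set E)) := fun i =>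
    (verts i).finite_toSet.isClosed_convexHull ℝ
  filter_upwards [hψ.eventually (mem_interior_iff_mem_nhds.1 hy),
    hψ.eventually (eventually_forall_mem_imp_mem hclosed y)] with z hz1 hz2
  obtain ⟨j, hj⟩ := mem_iUnion.1 hz1
  refine mem_iUnion.2 ⟨j, ?_⟩
  have hy'j : y' ∈ convexHull ℝ (verts j : Set E) :=
    convexHull_mono (by exact_mod_cast hstar j (hz2 j hj)) hy'
  have := (convex_convexHull ℝ (verts j : Set E)) hj hy'j ht0.le ht1'.le (by ring)
  convert this using 1
  simp only [ψ, smul_add, smul_smul, mul_inv_cancel₀ ht0.ne', one_smul]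
  rw [hxy]
  abel

open Filter Topology in
/-- If a continuous function has no zero on the boundary of a polyhedron, then it has the same
strict sign as its piecewise affine interpolant on that boundary. -/
theorem mul_pos_of_notMem_interior
    (hindep : ∀ i, AffineIndependent ℝ (fun v : (verts i : Set E) => (v : E)))
    (hface : ∀ i j, i ≠ j → ∃ F : Finset E, F ⊆ verts i ∧ F ⊆ verts j ∧
      convexHull ℝ (verts i : Set E) ∩ convexHull ℝ (verts j : Set E) = convexHull ℝ (F : Set E))
    {f ftilde : E → ℝ} (hf : Continuous f)
    (hcomb : ∀ i, ∀ μ : E → ℝ, (∀ v ∈ verts i, 0 ≤ μ v) → ∑ v ∈ verts i, μ v = 1 →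
      ftilde (∑ v ∈ verts i, μ v • v) = ∑ v ∈ verts i, μ v * f v)
    (hne : ∀ x ∈ ⋃ i, convexHull ℝ (verts i : Set E),
      x ∉ interior (⋃ i, convexHull ℝ (verts i : Set E)) → f x ≠ 0)
    {x : E} (hxK : x ∈ ⋃ i, convexHull ℝ (verts i : Set E))
    (hx : x ∉ interior (⋃ i, convexHull ℝ (verts i : Set E))) : 0 < f x * ftilde x := by
  classical
  obtain ⟨i, hi⟩ := mem_iUnion.1 hxK
  obtain ⟨μ, hμ, hμ1, hμx⟩ := Finset.mem_convexHull'.1 hi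
  let F := (verts i).filter fun v => μ v ≠ 0
  have hF : F ⊆ verts i := Finset.filter_subset _ _
  have hFpos : ∀ v ∈ F, 0 < μ v := fun v hv =>
    lt_of_le_of_ne (hμ v (hF hv)) (Finset.mem_filter.1 hv).2.symm
  have hF1 : ∑ v ∈ F, μ v = 1 := by rw [← hμ1]; exact Finset.sum_filter_ne_zero _
  have hFx : ∑ v ∈ F, μ v • v = x := by
    rw [← hμx]
    refine Finset.sum_subset hF fun v hv hvF => ?_
    have : μ v = 0 := by simpa [F, hv] using hvF
    rw [this, zero_smul]
  have hxF : x ∈ convexHull ℝ (F : Set E) :=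
    Finset.mem_convexHull'.2 ⟨μ, fun v hv => (hFpos v hv).le, hF1, hFx⟩
  have hdisj : ∀ y ∈ convexHull ℝ (F : Set E),
      y ∉ interior (⋃ i, convexHull ℝ (verts i : Set E)) := by
    intro y hy hyK
    obtain ⟨ν, hν, hν1, hνy⟩ := Finset.mem_convexHull'.1 hy
    have hcont : Continuous fun θ : ℝ => θ • x + (1 - θ) • y := by fun_prop
    have hev : ∀ᶠ θ : ℝ in 𝓝[>] 0,
        θ • x + (1 - θ) • y ∈ interior (⋃ i, convexHull ℝ (verts i : Set E)) :=
      nhdsWithin_le_nhds ((isOpen_interior.preimage hcont).mem_nhds (by simpa using hyK))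
    obtain ⟨θ, ⟨hθ, hθ0⟩, hθ1⟩ := ((hev.and eventually_mem_nhdsWithin).and
      (nhdsWithin_le_nhds (Iio_mem_nhds one_pos))).exists
    have hθ0 : 0 < θ := hθ0
    have hθ1 : 0 < 1 - θ := sub_pos.2 hθ1
    rw [← hFx] at hx
    refine hx (sum_smul_mem_interior_iUnion_convexHull hindep hface hF hFpos hF1
      (ν := fun v => θ * μ v + (1 - θ) * ν v) (fun v hv => ?_) ?_ ?_)
    · exact add_pos_of_pos_of_nonneg (mul_pos hθ0 (hFpos v hv)) (mul_nonneg hθ1.le (hν v hv))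
    · rw [Finset.sum_add_distrib, ← Finset.mul_sum, ← Finset.mul_sum, hF1, hν1]
      ring
    · simpa only [← hFx, ← hνy, Finset.smul_sum, add_smul, mul_smul, Finset.sum_add_distrib]
        using hθ
  have hFK : convexHull ℝ (F : Set E) ⊆ ⋃ i, convexHull ℝ (verts i : Set E) := fun y hy =>
    mem_iUnion.2 ⟨i, convexHull_mono (by exact_mod_cast hF) hy⟩
  have hsign : ∀ v ∈ F, 0 < f x * f v := by
    intro v hv
    by_contra hle
    have hord := ((convex_convexHull ℝ (F : Set E)).isPreconnected.image f
      hf.continuousOn).ordConnected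
    have h0 : (0 : ℝ) ∈ uIcc (f x) (f v) := by
      rw [mem_uIcc]
      rcases le_total (f x) 0 with h | h <;> rcases le_total (f v) 0 with h' | h'
      · have : f x = 0 ∨ f v = 0 := by
          by_contra! hcon
          exact hle (mul_pos_of_neg_of_neg (h.lt_of_ne hcon.1) (h'.lt_of_ne hcon.2))
        rcases this with h'' | h'' <;> simp [h'', h, h']
      · exact Or.inl ⟨h, h'⟩
      · exact Or.inr ⟨h', h⟩
      · have : f x = 0 ∨ f v = 0 := by
          by_contra! hcon
          exact hle (mul_pos (h.lt_of_ne hcon.1.symm) (h'.lt_of_ne hcon.2.symm))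
        rcases this with h'' | h'' <;> simp [h'', h, h']
    obtain ⟨p, hp, hp0⟩ := hord.uIcc_subset (mem_image_of_mem f hxF)
      (mem_image_of_mem f (subset_convexHull ℝ _ (Finset.mem_coe.2 hv))) h0
    exact hne p (hFK hp) (hdisj p hp) hp0
  have hval : ftilde x = ∑ v ∈ F, μ v * f v := by
    rw [← hμx, hcomb i μ hμ hμ1]
    symm
    refine Finset.sum_subset hF fun v hv hvF => ?_
    have : μ v = 0 := by simpa [F, hv] using hvF
    rw [this, zero_mul]
  have hFne : F.Nonempty := by
    rw [Finset.nonempty_iff_ne_empty]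
    rintro h
    simp [h] at hF1
  rw [hval, Finset.mul_sum]
  refine Finset.sum_pos (fun v hv => ?_) hFne
  rw [mul_left_comm]
  exact mul_pos (hFpos v hv) (hsign v hv)

end Simplicial

open Filter Topology in
/-- A continuous function whose right slopes have nonnegative lower limit is monotone. -/
theorem monotone_of_eventually_lt_slope {h : ℝ → ℝ} (hc : Continuous h)
    (hslope : ∀ s, ∀ r < 0, ∀ᶠ z in 𝓝[>] s, r < slope h s z) : Monotone h := by
  intro a b hab
  have := image_le_of_liminf_slope_right_le_deriv_boundary (f := fun s => -h s) (a := a) (b := b)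
    hc.neg.continuousOn (B := fun _ => -h a) (B' := fun _ => 0) le_rfl continuousOn_const
    (fun s _ => hasDerivWithinAt_const _ _ _) (fun s _ r hr => ?_) (right_mem_Icc.2 hab)
  · exact neg_le_neg_iff.1 this
  · refine Eventually.frequently ?_
    filter_upwards [hslope s (-r) (neg_lt_zero.2 hr)] with z hz
    rw [slope_def_field] at hz ⊢
    rw [show (-h z - -h s) / (z - s) = -((h z - h s) / (z - s)) by ring]
    linarith

open Filter Topology in
theorem Monotone.lt_of_eventually_slope_pos {h : ℝ → ℝ} (hm : Monotone h) {s t : ℝ} (hst : s < t)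
    (hslope : ∀ᶠ z in 𝓝[>] s, 0 < slope h s z) : h s < h t := by
  obtain ⟨z, ⟨hz, hsz⟩, hzt⟩ := ((hslope.and eventually_mem_nhdsWithin).and
    (nhdsWithin_le_nhds (Iio_mem_nhds hst))).exists
  have hsz : s < z := hsz
  rw [slope_def_field, div_pos_iff_of_pos_right (sub_pos.2 hsz), sub_pos] at hz
  exact hz.trans_le (hm (le_of_lt hzt))

open Filter Topology in
/-- Along a differentiable curve, the right slopes of a piecewise affine function are eventually
larger than any strict lower bound of the directional derivatives of the pieces at the point. -/
theorem eventually_lt_slope_of_piecewise_affine {E ι : Type*} [NormedAddCommGroup E]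
    [InnerProductSpace ℝ E] [Finite ι] {S : ι → Set E} (hS : ∀ i, IsClosed (S i)) {F : E → ℝ}
    {w : ι → E} {c : ι → ℝ} (haff : ∀ i, ∀ x ∈ S i, F x = ⟪w i, x⟫ + c i) {γ : ℝ → E} {v : E}
    {s r : ℝ} (hγ : HasDerivAt γ v s) (hmem : ∀ z, γ z ∈ ⋃ i, S i)
    (hr : ∀ i, γ s ∈ S i → r < ⟪w i, v⟫) :
    ∀ᶠ z in 𝓝[>] s, r < slope (fun z => F (γ z)) s z := by
  have hpieces : ∀ᶠ z in 𝓝[>] s, ∀ i, γ s ∈ S i → r < slope (fun z => ⟪w i, γ z⟫) s z := by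
    rw [eventually_all]
    intro i
    by_cases hi : γ s ∈ S i
    · have hd : HasDerivAt (fun z => ⟪w i, γ z⟫) ⟪w i, v⟫ s := by
        simpa using (hasDerivAt_const s (w i)).inner ℝ hγ
      filter_upwards [((hasDerivAt_iff_tendsto_slope.1 hd).mono_left
        (nhdsWithin_mono s fun z (hz : s < z) => hz.ne')).eventually_const_lt (hr i hi)] with z hz _
      exact hz
    · exact Eventually.of_forall fun z h => absurd h hi
  filter_upwards [hpieces, nhdsWithin_le_nhds
    (hγ.continuousAt.eventually (eventually_forall_mem_imp_mem hS (γ s)))] with z hz hzS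
  obtain ⟨i, hi⟩ := mem_iUnion.1 (hmem z)
  have := hz i (hzS i hi)
  rw [slope_def_field] at this ⊢
  rwa [haff i _ hi, haff i _ (hzS i hi), add_sub_add_right_eq_sub]

open Filter Topology in
/-- **Theorem 2** (codimension one, compact polyhedron). Let `K ⊆ ℝⁿ` be a compact
polyhedron with a simplicial decomposition `(S i)_{i ∈ ι}` (each `S i` the convex hull of a
finite affinely independent vertex set, pairwise intersections being common faces of
dimension at most `n - 1`, interiors disjoint). Let `f` be `C¹`, let `ftilde` be the
piecewise affine interpolant of `f` on the decomposition (affine with gradient `w i` and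
constant `c i` on `S i`, agreeing with `f` at the vertices), let
`V = {x ∈ K | f x = 0}`, `Ṽ = {x ∈ K | ftilde x = 0}`, `K(f) = {x ∈ K | f x * ftilde x ≤ 0}`,
`∇̃f(x) = {w i : x ∈ S i}` and `G(f, x) = {∇f(x)} ∪ ∇̃f(x)`. Assume `V ∩ ∂K = ∅`.
If `0 ∉ 𝓗(G(f, x))` for all `x ∈ K(f)`, then `V` and `Ṽ` are isotopic: there is a
continuous `H : [0,1] × K → K` with each `H (t, ·)` a homeomorphism of `K` onto itself
(a continuous bijection of the compact set `K` onto itself), `H (0, ·) = id` and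
`H (1, ·) '' V = Ṽ`. -/
theorem isotopy_of_piecewise_affine_approximation
    {n : ℕ} {ι : Type*} [Fintype ι]
    (K : Set (EuclideanSpace ℝ (Fin n))) (hKcomp : IsCompact K)
    (verts : ι → Finset (EuclideanSpace ℝ (Fin n)))
    (hindep : ∀ i, AffineIndependent ℝ
      (fun v : (verts i : Set (EuclideanSpace ℝ (Fin n))) => (v : EuclideanSpace ℝ (Fin n))))
    (S : ι → Set (EuclideanSpace ℝ (Fin n)))
    (hS : ∀ i, S i = convexHull ℝ (verts i : Set (EuclideanSpace ℝ (Fin n))))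
    (hcover : K = ⋃ i, S i)
    (hface : ∀ i j, i ≠ j → ∃ F : Finset (EuclideanSpace ℝ (Fin n)),
      F ⊆ verts i ∧ F ⊆ verts j ∧ F.card ≤ n ∧
      S i ∩ S j = convexHull ℝ (F : Set (EuclideanSpace ℝ (Fin n))))
    (hdisj : ∀ i j, i ≠ j → interior (S i) ∩ interior (S j) = ∅)
    (f : EuclideanSpace ℝ (Fin n) → ℝ) (hf : ContDiff ℝ 1 f)
    (ftilde : EuclideanSpace ℝ (Fin n) → ℝ)
    (w : ι → EuclideanSpace ℝ (Fin n)) (c : ι → ℝ)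
    (haff : ∀ i, ∀ x ∈ S i, ftilde x = ⟪w i, x⟫ + c i)
    (hinterp : ∀ i, ∀ v ∈ verts i, ftilde v = f v)
    (V : Set (EuclideanSpace ℝ (Fin n))) (hV : V = {x ∈ K | f x = 0})
    (Vt : Set (EuclideanSpace ℝ (Fin n))) (hVt : Vt = {x ∈ K | ftilde x = 0})
    (hboundary : V ∩ frontier K = ∅)
    (hcond : ∀ x ∈ {x ∈ K | f x * ftilde x ≤ 0},
      (0 : EuclideanSpace ℝ (Fin n)) ∉ convexHull ℝ
        (insert (gradient f x) {g | ∃ i, x ∈ S i ∧ g = w i})) :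
    ∃ H : ℝ × EuclideanSpace ℝ (Fin n) → EuclideanSpace ℝ (Fin n),
      ContinuousOn H (Icc (0 : ℝ) 1 ×ˢ K) ∧
      (∀ t ∈ Icc (0 : ℝ) 1, BijOn (fun x => H (t, x)) K K) ∧
      (∀ x ∈ K, H (0, x) = x) ∧
      (fun x => H (1, x)) '' V = Vt := by
  classical
  subst hV hVt
  have hKf : IsClosed K := hKcomp.isClosed
  have hSc : ∀ i, IsClosed (S i) := fun i => by
    rw [hS i]; exact (verts i).finite_toSet.isClosed_convexHull ℝ
  have hKS : K = ⋃ i, convexHull ℝ (verts i : Set (EuclideanSpace ℝ (Fin n))) := by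
    rw [hcover]; exact iUnion_congr hS
  have hftc : ContinuousOn ftilde K := by
    rw [hcover]
    refine (locallyFinite_of_finite S).continuousOn_iUnion hSc fun i => ?_
    have hc : ContinuousOn (fun x => ⟪w i, x⟫ + c i) (S i) :=
      Continuous.continuousOn (by fun_prop)
    exact hc.congr (haff i)
  set Z : Set (EuclideanSpace ℝ (Fin n)) := {x ∈ K | f x * ftilde x ≤ 0}
  have hZK : Z ⊆ K := fun x hx => hx.1
  have hZc : IsCompact Z := by
    refine hKcomp.of_isClosed_subset ?_ hZK
    exact ((hf.continuous.continuousOn.mul hftc).preimage_isClosed_of_isClosed hKf isClosed_Iic)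
  have hZint : Z ⊆ interior K := by
    rintro x ⟨hxK, hx⟩
    by_contra hxint
    refine hx.not_gt ?_
    rw [hKS] at hxK hxint
    refine mul_pos_of_notMem_interior hindep (fun i j hij => ?_) hf.continuous
      (fun i μ hμ hμ1 => ?_) (fun y hy hyint hy0 => ?_) hxK hxint
    · obtain ⟨F, hi, hj, -, hF⟩ := hface i j hij
      exact ⟨F, hi, hj, by rw [← hS i, ← hS j, hF]⟩
    · have hmem : ∑ v ∈ verts i, μ v • v ∈ S i := by
        rw [hS i]; exact Finset.mem_convexHull'.2 ⟨μ, hμ, hμ1, rfl⟩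
      have hv : ∀ v ∈ verts i, f v = ⟪w i, v⟫ + c i := fun v hv => by
        rw [← hinterp i v hv]
        exact haff i v (by rw [hS i]; exact subset_convexHull ℝ _ (Finset.mem_coe.2 hv))
      have hsum : ∑ v ∈ verts i, μ v * f v = ∑ v ∈ verts i, μ v * (⟪w i, v⟫ + c i) :=
        Finset.sum_congr rfl fun v hv' => by rw [hv v hv']
      rw [haff i _ hmem, hsum]
      simp_rw [mul_add, Finset.sum_add_distrib, inner_sum, real_inner_smul_right]
      rw [← Finset.sum_mul, hμ1, one_mul]
    · rw [← hKS] at hy hyint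
      have : y ∈ {x ∈ K | f x = 0} ∩ frontier K :=
        ⟨⟨hy, hy0⟩, by rw [hKf.frontier_eq]; exact ⟨hy, hyint⟩⟩
      rw [hboundary] at this
      exact this
  let G : EuclideanSpace ℝ (Fin n) → Set (EuclideanSpace ℝ (Fin n)) := fun x =>
    insert (gradient f x) {g | ∃ i, x ∈ S i ∧ g = w i}
  have hgrad : Continuous (gradient f) :=
    (InnerProductSpace.toDual ℝ _).symm.continuous.comp (hf.continuous_fderiv one_ne_zero)
  obtain ⟨X, hXd, hXs, hX0, hXnn, hXpos⟩ := exists_vectorField_inner_pos hZc isOpen_interior hZint G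
    (by
      intro x hx
      have hfin : (G x).Finite :=
        ((finite_range w).subset (by rintro _ ⟨i, -, rfl⟩; exact mem_range_self i)).insert _
      obtain ⟨e, he⟩ := hfin.exists_forall_inner_pos (hcond x hx)
      have hopen : ∀ᶠ y in 𝓝 x, 0 < ⟪gradient f y, e⟫ :=
        (isOpen_lt continuous_const (hgrad.inner continuous_const)).mem_nhds
          (he _ (mem_insert _ _))
      refine ⟨e, ?_⟩
      filter_upwards [hopen, eventually_forall_mem_imp_mem hSc x] with y hy hyS g hg
      rcases hg with rfl | ⟨i, hi, rfl⟩
      · exact hy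
      · exact he _ (mem_insert_of_mem _ ⟨i, hyS i hi, rfl⟩))
  obtain ⟨C, hC⟩ := hXd.lipschitzWith_of_hasCompactSupport hXs one_ne_zero
  obtain ⟨L, hL⟩ := hXs.exists_bound_of_continuous hXd.continuous
  obtain ⟨φ, hφ, hφ0⟩ := exists_flow_of_lipschitzWith_of_bounded (L := L.toNNReal) hC
    (fun x => (hL x).trans (Real.le_coe_toNNReal L))
  have hinv : IsInvariant φ K := by
    intro t x hx
    by_contra hxt
    have hfix := hφ0 (φ t x) (hX0 _ fun h => hxt (interior_subset h)) (-t)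
    rw [← φ.map_add, neg_add_cancel, φ.map_zero_apply] at hfix
    exact hxt (by rwa [← hfix])
  have hfd : ∀ x s, HasDerivAt (fun s => f (φ s x)) ⟪gradient f (φ s x), X (φ s x)⟫ s := by
    intro x s
    have hg := (hf.differentiable one_ne_zero (φ s x)).hasGradientAt.hasFDerivAt
    exact hg.comp_hasDerivAt s (hφ x s)
  let ψ : Flow ℝ K := φ.restrict hinv
  have hfψ : ψ.IsTransverseAtZeros fun x => f x := by
    have hmono : ∀ x : K, Monotone fun s => f (ψ s x) := fun x =>
      monotone_of_hasDerivAt_nonneg (hfd x) fun s => hXnn _ _ (mem_insert _ _)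
    refine ⟨hf.continuous.comp continuous_subtype_val, hmono, fun x hx s hs => ?_⟩
    have hd := hfd x 0
    rw [φ.map_zero_apply] at hd
    have hpos := hXpos x ⟨x.2, by simp [hx]⟩ _ (mem_insert _ _)
    have := (hmono x).lt_of_eventually_slope_pos hs
      (((hasDerivAt_iff_tendsto_slope.1 hd).mono_left
        (nhdsWithin_mono 0 fun z (hz : 0 < z) => hz.ne')).eventually_const_lt hpos)
    rwa [ψ.map_zero_apply, hx] at this
  have hmemψ : ∀ (x : K) (s : ℝ), φ s x ∈ ⋃ i, S i := fun x s => hcover ▸ hinv s x.2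
  have hgψ : ψ.IsTransverseAtZeros fun x => ftilde x := by
    have hcont : Continuous fun x : K => ftilde x := hftc.domRestrict
    have hmono : ∀ x : K, Monotone fun s => ftilde (ψ s x) := fun x =>
      monotone_of_eventually_lt_slope
        (hcont.comp (ψ.continuous continuous_id continuous_const)) fun s r hr =>
          eventually_lt_slope_of_piecewise_affine hSc haff (hφ x s) (hmemψ x) fun i hi =>
            hr.trans_le (hXnn _ _ (mem_insert_of_mem _ ⟨i, hi, rfl⟩))
    refine ⟨hcont, hmono, fun x hx s hs => ?_⟩
    have := (hmono x).lt_of_eventually_slope_pos hs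
      (eventually_lt_slope_of_piecewise_affine hSc haff (hφ x 0) (hmemψ x) fun i hi => by
        replace hi : φ 0 x ∈ S i := hi
        rw [φ.map_zero_apply] at hi ⊢
        exact hXpos x ⟨x.2, by simp [hx]⟩ _ (mem_insert_of_mem _ ⟨i, hi, rfl⟩))
    rwa [ψ.map_zero_apply, hx] at this
  obtain ⟨T, hT0, hT⟩ : ∃ T : ℝ, 0 ≤ T ∧
      ∀ x : K, ∃ s ∈ Icc 0 T, 0 < f (ψ s x) * ftilde (ψ s x) := by
    rcases Z.eq_empty_or_nonempty with hZe | hZne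
    · refine ⟨0, le_rfl, fun x => ⟨0, by simp, ?_⟩⟩
      rw [ψ.map_zero_apply]
      by_contra hle
      exact (hZe ▸ (⟨x.2, not_lt.1 hle⟩ : (x : EuclideanSpace ℝ (Fin n)) ∈ Z) :
        (x : EuclideanSpace ℝ (Fin n)) ∈ (∅ : Set _))
    obtain ⟨z, hz, hzmin⟩ := hZc.exists_isMinOn hZne
      (hgrad.inner hXd.continuous (𝕜 := ℝ)).continuousOn
    have hm := hXpos z hz _ (mem_insert _ _)
    set m := ⟪gradient f z, X z⟫
    obtain ⟨B, hB⟩ := hKcomp.exists_bound_of_continuousOn hf.continuous.continuousOn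
    refine ⟨(2 * |B| + 1) / m, by positivity, fun x => ?_⟩
    by_contra! hcon
    have hT0 : 0 ≤ (2 * |B| + 1) / m := by positivity
    have hgrow := (convex_Icc 0 ((2 * |B| + 1) / m)).mul_sub_le_image_sub_of_le_deriv
      (f := fun s => f (φ s x)) (C := m)
      (fun s _ => (hfd x s).continuousAt.continuousWithinAt)
      (fun s _ => (hfd x s).differentiableAt.differentiableWithinAt)
      (fun s hs => by
        rw [(hfd x s).deriv]
        exact hzmin ⟨hinv s x.2, hcon s (interior_subset hs)⟩)
      0 (left_mem_Icc.2 hT0) _ (right_mem_Icc.2 hT0) hT0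
    rw [sub_zero, mul_div_cancel₀ _ hm.ne'] at hgrow
    have h1 := hB _ (hinv 0 x.2)
    have h2 := hB _ (hinv ((2 * |B| + 1) / m) x.2)
    rw [Real.norm_eq_abs, abs_le] at h1 h2
    linarith [le_abs_self B, h1.1, h2.2]
  have hfut : ∀ x : K, ∃ s ≥ 0, 0 < f (ψ s x) * ftilde (ψ s x) := fun x => by
    obtain ⟨s, hs, h⟩ := hT x
    exact ⟨s, hs.1, h⟩
  have hpast : ∀ x : K, ∃ s ≤ 0, 0 < f (ψ s x) * ftilde (ψ s x) := fun x => by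
    obtain ⟨s, hs, h⟩ := hT (ψ (-T) x)
    rw [← ψ.map_add] at h
    exact ⟨s + -T, by linarith [hs.2], h⟩
  have : CompactSpace K := isCompact_iff_compactSpace.1 hKcomp
  obtain ⟨H, hHc, hHb, hH0, hH1⟩ := ψ.exists_isotopy_of_isTransverseAtZeros hfψ hgψ
    (fun x hx => hfψ.exists_zero_of_mul_pos hgψ hx (hfut x) (hpast x))
    (fun x hx => hgψ.exists_zero_of_mul_pos hfψ hx (by simpa only [mul_comm] using hfut x)
      (by simpa only [mul_comm] using hpast x))
  let H' : ℝ × EuclideanSpace ℝ (Fin n) → EuclideanSpace ℝ (Fin n) := fun p =>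
    if hp : p.2 ∈ K then H (p.1, ⟨p.2, hp⟩) else p.2
  have hH' : ∀ t (x : K), H' (t, x) = H (t, x) := fun t x => dif_pos x.2
  refine ⟨H', ?_, fun t ht => ⟨?_, ?_, ?_⟩, ?_, ?_⟩
  · rw [continuousOn_iff_continuous_domRestrict]
    have hc : Continuous fun p : (Icc (0 : ℝ) 1 ×ˢ K : Set (ℝ × EuclideanSpace ℝ (Fin n))) =>
        ((H (p.1.1, ⟨p.1.2, p.2.2⟩) : K) : EuclideanSpace ℝ (Fin n)) := by fun_prop
    refine hc.congr fun p => ?_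
    exact (hH' p.1.1 ⟨p.1.2, p.2.2⟩).symm
  · intro x hx
    have hmem := (H (t, ⟨x, hx⟩)).2
    rw [← hH' t ⟨x, hx⟩] at hmem
    exact hmem
  · intro x hx y hy hxy
    have hxy' : H' (t, x) = H' (t, y) := hxy
    rw [hH' t ⟨x, hx⟩, hH' t ⟨y, hy⟩] at hxy'
    exact congrArg Subtype.val ((hHb t ht).1 (Subtype.ext hxy'))
  · intro y hy
    obtain ⟨x, hx⟩ := (hHb t ht).2 ⟨y, hy⟩
    exact ⟨x, x.2, (hH' t x).trans (congrArg Subtype.val hx)⟩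
  · intro x hx
    rw [hH' 0 ⟨x, hx⟩, hH0]
  · ext y
    constructor
    · rintro ⟨x, ⟨hxK, hx⟩, rfl⟩
      have hmem : H (1, ⟨x, hxK⟩) ∈ {x : K | ftilde x = 0} := by
        rw [← hH1]; exact mem_image_of_mem _ hx
      have heq : H' (1, x) = H (1, ⟨x, hxK⟩) := hH' 1 ⟨x, hxK⟩
      simp only [heq]
      exact ⟨(H (1, ⟨x, hxK⟩)).2, hmem⟩
    · rintro ⟨hyK, hy⟩
      have hmem : (⟨y, hyK⟩ : K) ∈ {x : K | ftilde x = 0} := hy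
      rw [← hH1] at hmem
      obtain ⟨x, hx, hxy⟩ := hmem
      exact ⟨x, ⟨x.2, hx⟩, (hH' 1 x).trans (congrArg Subtype.val hxy)⟩
end

section
/- Let 1 < m ≤ n be natural numbers and let S be a set of m×n real matrices. If S is strongly full rank, i.e. for every sign vector σ ∈ {−1,1}^m the origin 0 of ℝⁿ does not belong to the convex hull of the set of signed rows {σ_i · (row_i A) : 1 ≤ i ≤ m, A ∈ S}, then every matrix in the convex hull of S (taken in the space of m×n matrices) has rank m. -/
/-- Each signed row of a matrix in the convex hull of `S` lies in the convex hull of the signed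
rows of the matrices in `S`. -/
theorem smul_row_mem_convexHull {ι κ : Type*} {S : Set (Matrix ι κ ℝ)} {B : Matrix ι κ ℝ}
    (hB : B ∈ convexHull ℝ S) (σ : ι → ℝ) (i : ι) :
    σ i • B i ∈ convexHull ℝ {v : κ → ℝ | ∃ A ∈ S, ∃ j : ι, v = σ j • A j} := by
  let f : Matrix ι κ ℝ →ₗ[ℝ] (κ → ℝ) := σ i • LinearMap.proj i
  have hmem : f B ∈ convexHull ℝ (f '' S) := by
    rw [← f.image_convexHull]
    exact Set.mem_image_of_mem f hB
  refine convexHull_mono ?_ hmem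
  rintro _ ⟨A, hA, rfl⟩
  exact ⟨A, hA, i, rfl⟩

/-- If a set `S` of `m × n` real matrices (with `1 < m ≤ n`) is strongly full rank, i.e.
for every sign vector `σ ∈ {-1, 1}^m` the origin does not belong to the convex hull of the
signed rows `{σ i • (row i of A) : A ∈ S, 1 ≤ i ≤ m}`, then every matrix in the convex hull
of `S` has rank `m`. -/
theorem rank_of_mem_convexHull_of_stronglyFullRank
    {m n : ℕ} (hm : 1 < m) (hmn : m ≤ n)
    (S : Set (Matrix (Fin m) (Fin n) ℝ))
    (hstrong : ∀ σ : Fin m → ℝ, (∀ i, σ i = 1 ∨ σ i = -1) →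
      (0 : Fin n → ℝ) ∉ convexHull ℝ {v | ∃ A ∈ S, ∃ i : Fin m, v = σ i • A i}) :
    ∀ B ∈ convexHull ℝ S, B.rank = m := by
  intro B hB
  suffices h : LinearIndependent ℝ B.row by simpa using h.rank_matrix
  rw [Fintype.linearIndependent_iff]
  intro g hg
  by_contra! hne
  obtain ⟨k, hk⟩ := hne
  let σ : Fin m → ℝ := fun i => if g i < 0 then -1 else 1
  have hσ : ∀ i, σ i = 1 ∨ σ i = -1 := fun i => by
    by_cases h : g i < 0 <;> simp [σ, h]
  have habs : ∀ i, |g i| * σ i = g i := fun i => by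
    by_cases h : g i < 0
    · simp [σ, h, abs_of_neg h]
    · simp [σ, h, abs_of_nonneg (not_lt.mp h)]
  have hpos : 0 < ∑ i, |g i| :=
    Finset.sum_pos' (fun i _ => abs_nonneg _) ⟨k, Finset.mem_univ k, abs_pos.mpr hk⟩
  apply hstrong σ hσ
  have hcenter : Finset.univ.centerMass (fun i => |g i|) (fun i => σ i • B i) = 0 := by
    have hsum : ∑ i, |g i| • σ i • B i = 0 := by
      simp only [smul_smul, habs]
      exact hg
    rw [Finset.centerMass, hsum, smul_zero]
  rw [← hcenter]
  exact (convex_convexHull ℝ _).centerMass_mem (fun i _ => abs_nonneg _) hpos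
    (fun i _ => smul_row_mem_convexHull hB σ i)
end

section
/- Let K ⊆ ℝⁿ be a nonempty compact set, let g : ℝⁿ → ℝⁿ be continuous, and let T assign to each point x ∈ ℝⁿ a finite subset T(x) ⊆ ℝⁿ such that for every x there exists δ > 0 with T(y) ⊆ T(x) whenever ‖y − x‖ < δ. If for every x ∈ K the origin 0 does not belong to the convex hull of {g(x)} ∪ T(x), then there exists ε > 0 such that for every x ∈ K, 0 does not belong to the convex hull of ⋃_{y ∈ K, ‖y−x‖<ε} ({g(y)} ∪ T(y)). -/
open Set

/-- A closed convex hull missing the origin lies in an open convex set missing the origin. -/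
theorem exists_isOpen_convex_zero_notMem {E : Type*} [AddCommGroup E] [Module ℝ E]
    [TopologicalSpace E] [IsTopologicalAddGroup E] [ContinuousSMul ℝ E] [LocallyConvexSpace ℝ E]
    {s : Set E} (hs : IsClosed (convexHull ℝ s)) (h0 : (0 : E) ∉ convexHull ℝ s) :
    ∃ H : Set E, IsOpen H ∧ Convex ℝ H ∧ s ⊆ H ∧ (0 : E) ∉ H := by
  obtain ⟨f, u, hu0, hu⟩ := geometric_hahn_banach_point_closed (convex_convexHull ℝ s) hs h0
  exact ⟨{z | u < f z}, isOpen_lt continuous_const f.continuous,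
    convex_halfSpace_gt f.toLinearMap.isLinear u,
    fun z hz => hu z (subset_convexHull ℝ s hz), hu0.not_gt⟩

/-- Uniform separation from `0` of convex hulls, by compactness: if `g` is continuous,
`T` assigns to each point a finite set of vectors and is locally decreasing
(`T y ⊆ T x` for `y` near `x`), and for every `x` in the nonempty compact set `K` the
origin is not in the convex hull of `{g x} ∪ T x`, then there is a uniform `ε > 0` such
that for every `x ∈ K` the origin is not in the convex hull of the union of the sets
`{g y} ∪ T y` over all `y ∈ K` with `‖y - x‖ < ε`. -/
theorem uniform_separation_of_convexHulls
    {n : ℕ} (K : Set (EuclideanSpace ℝ (Fin n)))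
    (hKne : K.Nonempty) (hKcomp : IsCompact K)
    (g : EuclideanSpace ℝ (Fin n) → EuclideanSpace ℝ (Fin n)) (hg : Continuous g)
    (T : EuclideanSpace ℝ (Fin n) → Finset (EuclideanSpace ℝ (Fin n)))
    (hT : ∀ x : EuclideanSpace ℝ (Fin n), ∃ δ > (0 : ℝ),
      ∀ y : EuclideanSpace ℝ (Fin n), ‖y - x‖ < δ → T y ⊆ T x)
    (hsep : ∀ x ∈ K, (0 : EuclideanSpace ℝ (Fin n)) ∉
      convexHull ℝ ({g x} ∪ (T x : Set (EuclideanSpace ℝ (Fin n))))) :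
    ∃ ε > (0 : ℝ), ∀ x ∈ K, (0 : EuclideanSpace ℝ (Fin n)) ∉
      convexHull ℝ (⋃ y ∈ {y ∈ K | ‖y - x‖ < ε},
        ({g y} ∪ (T y : Set (EuclideanSpace ℝ (Fin n))))) := by
  have hH : ∀ x ∈ K, ∃ H : Set (EuclideanSpace ℝ (Fin n)), IsOpen H ∧ Convex ℝ H ∧
      {g x} ∪ (T x : Set (EuclideanSpace ℝ (Fin n))) ⊆ H ∧ 0 ∉ H := fun x hx =>
    exists_isOpen_convex_zero_notMem
      (((finite_singleton (g x)).union (T x).finite_toSet).isClosed_convexHull ℝ) (hsep x hx)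
  choose! H hHo hHc hHs hH0 using hH
  choose δ hδ hTδ using hT
  obtain ⟨ε, hε, hball⟩ := lebesgue_number_lemma_of_metric (ι := K) hKcomp
    (c := fun x => Metric.ball (x : EuclideanSpace ℝ (Fin n)) (δ x) ∩ g ⁻¹' H x)
    (fun x => Metric.isOpen_ball.inter ((hHo x x.2).preimage hg))
    (fun x hx => mem_iUnion.2 ⟨⟨x, hx⟩, Metric.mem_ball_self (hδ x), hHs x hx (by simp)⟩)
  refine ⟨ε, hε, fun x hx h0 => ?_⟩
  obtain ⟨⟨z, hz⟩, hxz⟩ := hball x hx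
  refine hH0 z hz (convexHull_min (iUnion₂_subset fun y hy => ?_) (hHc z hz) h0)
  obtain ⟨hyz, hgy⟩ := hxz (mem_ball_iff_norm.2 hy.2)
  exact union_subset (singleton_subset_iff.2 hgy)
    fun t ht => hHs z hz (Or.inr (hTδ z y (mem_ball_iff_norm.1 hyz) ht))
end

section
/- Let ε > 0, let μ : ℝⁿ → ℝ be integrable with μ ≥ 0, support of μ contained in the closed ball of radius ε around 0, and ∫_{ℝⁿ} μ = 1. Let N : ℝⁿ → ℝⁿ be measurable and bounded, let x ∈ ℝⁿ and v ∈ ℝⁿ, and assume N(y)·v > 0 for every y with ‖y − x‖ ≤ ε. Then the mollified value N'(x) = ∫_{ℝⁿ} μ(u) N(x − u) du satisfies N'(x)·v > 0. -/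
open MeasureTheory RealInnerProductSpace

/-- Convolution smoothing preserves strict positivity of scalar products: if `μ ≥ 0` is an
integrable kernel of total mass `1` supported in the closed ball of radius `ε` around `0`,
`N` is a bounded measurable vector field, and `⟪N y, v⟫ > 0` for every `y` with
`‖y - x‖ ≤ ε`, then the mollified value `N'(x) = ∫ μ(u) N(x - u) du` satisfies
`⟪N'(x), v⟫ > 0`. -/
theorem mollified_inner_pos
    {n : ℕ} (ε : ℝ) (hε : 0 < ε)
    (μ : EuclideanSpace ℝ (Fin n) → ℝ)
    (hμint : Integrable μ)
    (hμ0 : ∀ u, 0 ≤ μ u)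
    (hμsupp : Function.support μ ⊆ Metric.closedBall (0 : EuclideanSpace ℝ (Fin n)) ε)
    (hμ1 : ∫ u, μ u = 1)
    (N : EuclideanSpace ℝ (Fin n) → EuclideanSpace ℝ (Fin n))
    (hNmeas : Measurable N)
    (C : ℝ) (hNbdd : ∀ y, ‖N y‖ ≤ C)
    (x v : EuclideanSpace ℝ (Fin n))
    (hpos : ∀ y, ‖y - x‖ ≤ ε → 0 < ⟪N y, v⟫) :
    0 < ⟪∫ u, μ u • N (x - u), v⟫ := by
  have hint : Integrable fun u => μ u • N (x - u) :=
    hμint.smul_bdd C (hNmeas.comp (measurable_id.const_sub x)).aestronglyMeasurable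
      (Filter.Eventually.of_forall fun u => hNbdd (x - u))
  have hball : ∀ u, μ u ≠ 0 → 0 < ⟪v, N (x - u)⟫ := fun u hu => by
    have hu' : ‖u‖ ≤ ε := by simpa using hμsupp hu
    rw [real_inner_comm]
    exact hpos _ (by simpa using hu')
  have hnonneg : ∀ u, 0 ≤ ⟪v, μ u • N (x - u)⟫ := fun u => by
    rw [real_inner_smul_right]
    by_cases hu : μ u = 0
    · simp [hu]
    · exact mul_nonneg (hμ0 u) (hball u hu).le
  have hsupp : Function.support μ ⊆ Function.support fun u => ⟪v, μ u • N (x - u)⟫ :=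
    fun u hu => by
      rw [Function.mem_support, real_inner_smul_right]
      exact mul_ne_zero hu (hball u hu).ne'
  have hμpos : 0 < volume (Function.support μ) :=
    (integral_pos_iff_support_of_nonneg hμ0 hμint).1 (hμ1 ▸ one_pos)
  rw [real_inner_comm, ← integral_inner hint]
  exact (integral_pos_iff_support_of_nonneg hnonneg (hint.const_inner v)).2
    (hμpos.trans_le (measure_mono hsupp))
end

section
/- Let E be a real inner product space and let N, V ∈ E with N ≠ 0 and ⟨N, V⟩ ≤ 0. Then for every real α with 0 < α and α·‖V‖² < (2 + α)·‖N‖², one has ‖(N + α V)/(1 + α)‖ < ‖N‖. In particular, for any such N and V there exists α > 0 making the norm strictly decrease. -/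
open RealInnerProductSpace

/-- If `⟪N, V⟫ ≤ 0`, then `‖(N + α V)/(1 + α)‖ < ‖N‖` for every `α > 0` with
`α * ‖V‖² < (2 + α) * ‖N‖²`. -/
theorem norm_inv_smul_add_smul_lt {E : Type*} [NormedAddCommGroup E] [InnerProductSpace ℝ E]
    {N V : E} (hNV : ⟪N, V⟫ ≤ 0) {α : ℝ} (hα : 0 < α)
    (h : α * ‖V‖ ^ 2 < (2 + α) * ‖N‖ ^ 2) :
    ‖(1 + α)⁻¹ • (N + α • V)‖ < ‖N‖ := by
  have hpos : 0 < 1 + α := by linarith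
  have hsq : ‖N + α • V‖ ^ 2 = ‖N‖ ^ 2 + 2 * (α * ⟪N, V⟫) + α ^ 2 * ‖V‖ ^ 2 := by
    rw [norm_add_sq_real, real_inner_smul_right, norm_smul, mul_pow, Real.norm_eq_abs, sq_abs]
  rw [norm_smul, norm_inv, Real.norm_of_nonneg hpos.le, inv_mul_lt_iff₀ hpos]
  refine lt_of_pow_lt_pow_left₀ 2 (by positivity) ?_
  rw [hsq]
  nlinarith [mul_lt_mul_of_pos_left h hα, mul_nonpos_of_nonneg_of_nonpos hα.le hNV]

/-- The descent-step inequality: if `⟪N, V⟫ ≤ 0` and `N ≠ 0`, then for every `α > 0` with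
`α * ‖V‖² < (2 + α) * ‖N‖²` one has `‖(N + α V)/(1 + α)‖ < ‖N‖`; in particular some
`α > 0` makes the norm strictly decrease. -/
theorem descent_step {E : Type*} [NormedAddCommGroup E] [InnerProductSpace ℝ E]
    (N V : E) (hN : N ≠ 0) (hNV : ⟪N, V⟫ ≤ 0) :
    (∀ α : ℝ, 0 < α → α * ‖V‖ ^ 2 < (2 + α) * ‖N‖ ^ 2 →
      ‖(1 + α)⁻¹ • (N + α • V)‖ < ‖N‖) ∧
    (∃ α : ℝ, 0 < α ∧ ‖(1 + α)⁻¹ • (N + α • V)‖ < ‖N‖) := by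
  have hN2 : 0 < ‖N‖ ^ 2 := by positivity
  refine ⟨fun α hα h => norm_inv_smul_add_smul_lt hNV hα h, ‖N‖ ^ 2 / (‖V‖ ^ 2 + 1),
    by positivity, norm_inv_smul_add_smul_lt hNV (by positivity) ?_⟩
  have hα : 0 < ‖N‖ ^ 2 / (‖V‖ ^ 2 + 1) := by positivity
  have hmul : ‖N‖ ^ 2 / (‖V‖ ^ 2 + 1) * (‖V‖ ^ 2 + 1) = ‖N‖ ^ 2 :=
    div_mul_cancel₀ _ (by positivity)
  nlinarith [mul_pos hα hN2]
end

section
/- Let K ⊆ ℝⁿ be a compact polyhedron with a simplicial decomposition (S_i)_{i∈I} and f : ℝⁿ → ℝ of class C¹. For t ∈ [0,1] define f_t = t·f + (1−t)·f̃ on K. Then for every x ∈ K, every direction D ∈ ℝⁿ such that x + hD ∈ K for all sufficiently small h > 0, and every t ∈ [0,1], the one-sided directional derivative lim_{h→0⁺} (f_t(x + hD) − f_t(x))/h exists and equals ⟨W, D⟩ for some vector W belonging to the convex hull of G(f,x); more precisely W = t·∇f(x) + (1−t)·A for some A ∈ ∇̃f(x). -/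
open Set Filter RealInnerProductSpace

/-- If a ray from `x` initially stays in a finite union of closed convex sets, then it initially
stays in one of them, which moreover contains `x`. -/
lemma exists_mem_and_eventually_add_smul_mem {E ι : Type*} [AddCommGroup E] [Module ℝ E]
    [TopologicalSpace E] [ContinuousAdd E] [ContinuousSMul ℝ E] [Finite ι]
    {S : ι → Set E} (hclosed : ∀ i, IsClosed (S i)) (hconv : ∀ i, Convex ℝ (S i)) {x D : E}
    (hD : ∀ᶠ h : ℝ in nhdsWithin 0 (Ioi 0), x + h • D ∈ ⋃ i, S i) :
    ∃ i, x ∈ S i ∧ ∀ᶠ h : ℝ in nhdsWithin 0 (Ioi 0), x + h • D ∈ S i := by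
  obtain ⟨i, hi⟩ : ∃ i, ∃ᶠ h : ℝ in nhdsWithin 0 (Ioi 0), x + h • D ∈ S i := by
    by_contra! hcon
    have hall : ∀ᶠ h : ℝ in nhdsWithin 0 (Ioi 0), ∀ i, x + h • D ∉ S i :=
      eventually_all.2 hcon
    obtain ⟨h, hmem, hnot⟩ := (hD.and hall).exists
    obtain ⟨i, hi⟩ := mem_iUnion.1 hmem
    exact hnot i hi
  have hlim : Tendsto (fun h : ℝ => x + h • D) (nhdsWithin 0 (Ioi 0)) (nhds x) := by
    have hcont : Continuous fun h : ℝ => x + h • D := by fun_prop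
    simpa using (hcont.tendsto 0).mono_left nhdsWithin_le_nhds
  have hx : x ∈ S i := (hclosed i).mem_of_frequently_of_tendsto hi hlim
  obtain ⟨k, hk, hkpos⟩ := (hi.and_eventually self_mem_nhdsWithin).exists
  have hkpos : 0 < k := hkpos
  refine ⟨i, hx, ?_⟩
  filter_upwards [Ioo_mem_nhdsGT hkpos] with h hh
  have hmem := (hconv i).add_smul_mem hx hk
    (t := h / k) ⟨div_nonneg hh.1.le hkpos.le, (div_le_one hkpos).2 hh.2.le⟩
  rwa [smul_smul, div_mul_cancel₀ _ hkpos.ne'] at hmem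

/-- The one-sided directional derivative of a differentiable function is given by its gradient. -/
lemma DifferentiableAt.tendsto_slope_gradient {E : Type*} [NormedAddCommGroup E]
    [InnerProductSpace ℝ E] [CompleteSpace E] {f : E → ℝ} {x : E}
    (hf : DifferentiableAt ℝ f x) (D : E) :
    Tendsto (fun h : ℝ => (f (x + h • D) - f x) / h) (nhdsWithin 0 (Ioi 0))
      (nhds ⟪gradient f x, D⟫) := by
  have hline := (hf.hasGradientAt.hasFDerivAt.hasLineDerivAt D).tendsto_slope_zero_right
  simpa [div_eq_inv_mul] using hline

/-- One-sided directional derivatives of the interpolation `f_t = t f + (1 - t) f̃`.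
With `K`, a simplicial decomposition `(S i)`, `f` of class `C¹` and `ftilde` its piecewise
affine interpolant (affine with gradient `w i` and constant `c i` on each `S i`, agreeing
with `f` at the vertices) as in Theorem 2: for every `x ∈ K`, every direction `D` such that
`x + h • D ∈ K` for all sufficiently small `h > 0`, and every `t ∈ [0,1]`, the one-sided
directional derivative `lim_{h → 0⁺} (f_t (x + h D) - f_t x) / h` exists and equals
`⟪W, D⟫` where `W = t • ∇f(x) + (1 - t) • A` for some `A ∈ ∇̃f(x) = {w i : x ∈ S i}`;
in particular `W` belongs to the convex hull of `G(f, x) = {∇f(x)} ∪ ∇̃f(x)`. -/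
theorem onesided_directional_derivative_of_interpolation
    {n : ℕ} {ι : Type*} [Fintype ι]
    (K : Set (EuclideanSpace ℝ (Fin n))) (hKcomp : IsCompact K)
    (verts : ι → Finset (EuclideanSpace ℝ (Fin n)))
    (hindep : ∀ i, AffineIndependent ℝ
      (fun v : (verts i : Set (EuclideanSpace ℝ (Fin n))) => (v : EuclideanSpace ℝ (Fin n))))
    (S : ι → Set (EuclideanSpace ℝ (Fin n)))
    (hS : ∀ i, S i = convexHull ℝ (verts i : Set (EuclideanSpace ℝ (Fin n))))
    (hcover : K = ⋃ i, S i)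
    (hface : ∀ i j, i ≠ j → ∃ F : Finset (EuclideanSpace ℝ (Fin n)),
      F ⊆ verts i ∧ F ⊆ verts j ∧ F.card ≤ n ∧
      S i ∩ S j = convexHull ℝ (F : Set (EuclideanSpace ℝ (Fin n))))
    (hdisj : ∀ i j, i ≠ j → interior (S i) ∩ interior (S j) = ∅)
    (f : EuclideanSpace ℝ (Fin n) → ℝ) (hf : ContDiff ℝ 1 f)
    (ftilde : EuclideanSpace ℝ (Fin n) → ℝ)
    (w : ι → EuclideanSpace ℝ (Fin n)) (c : ι → ℝ)
    (haff : ∀ i, ∀ x ∈ S i, ftilde x = ⟪w i, x⟫ + c i)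
    (hinterp : ∀ i, ∀ v ∈ verts i, ftilde v = f v)
    (x : EuclideanSpace ℝ (Fin n)) (hx : x ∈ K)
    (D : EuclideanSpace ℝ (Fin n))
    (hD : ∃ h₀ > (0 : ℝ), ∀ h : ℝ, 0 < h → h < h₀ → x + h • D ∈ K)
    (t : ℝ) (ht : t ∈ Icc (0 : ℝ) 1) :
    ∃ A : EuclideanSpace ℝ (Fin n),
      (∃ i, x ∈ S i ∧ A = w i) ∧
      (t • gradient f x + (1 - t) • A) ∈
        convexHull ℝ (insert (gradient f x) {g | ∃ i, x ∈ S i ∧ g = w i}) ∧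
      Tendsto (fun h : ℝ =>
          ((t * f (x + h • D) + (1 - t) * ftilde (x + h • D)) -
            (t * f x + (1 - t) * ftilde x)) / h)
        (nhdsWithin (0 : ℝ) (Ioi 0))
        (nhds ⟪t • gradient f x + (1 - t) • A, D⟫) := by
  have hclosed : ∀ i, IsClosed (S i) := fun i => by
    rw [hS i]
    exact (verts i).finite_toSet.isClosed_convexHull ℝ
  have hconv : ∀ i, Convex ℝ (S i) := fun i => by
    rw [hS i]
    exact convex_convexHull ℝ _
  have hray : ∀ᶠ h : ℝ in nhdsWithin 0 (Ioi 0), x + h • D ∈ ⋃ i, S i := by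
    obtain ⟨h₀, hpos, hmem⟩ := hD
    filter_upwards [Ioo_mem_nhdsGT hpos] with h hh
    exact hcover ▸ hmem h hh.1 hh.2
  obtain ⟨i, hxi, hi⟩ := exists_mem_and_eventually_add_smul_mem hclosed hconv hray
  refine ⟨w i, ⟨i, hxi, rfl⟩, ?_, ?_⟩
  · refine convex_convexHull ℝ _ (subset_convexHull ℝ _ (mem_insert _ _))
      (subset_convexHull ℝ _ (mem_insert_of_mem _ ?_)) ht.1 (sub_nonneg.2 ht.2) (add_sub_cancel _ _)
    exact ⟨i, hxi, rfl⟩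
  · have hgrad := (hf.differentiable one_ne_zero x).tendsto_slope_gradient D
    have hlim := (hgrad.const_mul t).add_const ((1 - t) * ⟪w i, D⟫)
    rw [inner_add_left, real_inner_smul_left, real_inner_smul_left]
    refine hlim.congr' ?_
    filter_upwards [hi, self_mem_nhdsWithin] with h hh hpos
    have hne : h ≠ 0 := ne_of_gt hpos
    rw [haff i _ hh, haff i _ hxi, inner_add_right, real_inner_smul_right]
    field_simp
    ring
end
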